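/- arXiv:2403.18966 — 10 statements merged into one kernel-verified Lean document; each statement's English description precedes it below -/
import Mathlib

section
/- Let æ ≥ 1 and M ≥ 0 be integers. Let F and F′ be finite subsets of the interval [0,1) with |F| ≤ æ and |F′| ≤ æ, and for each γ ∈ F (respectively γ ∈ F′) let q_γ (respectively q′_γ) be a nonzero complex polynomial of degree at most M. Define x(t) = Σ_{γ∈F} q_γ(t)·e^{2πiγt} and y(t) = Σ_{γ∈F′} q′_γ(t)·e^{2πiγt} for t ∈ ℝ. If x(ℓ) = y(ℓ) for every integer ℓ with 0 ≤ ℓ ≤ 2æ(M+1) − 1, then x(t) = y(t) for all t ∈ ℝ; in particular F = F′ and q_γ = q′_γ for every γ ∈ F. -/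
open Polynomial

namespace Polynomial

variable {K : Type*} [Field K]

theorem degree_taylor_sub_self_lt [CharZero K] {p : K[X]} {d : ℕ} (r : K)
    (hp : p.degree < (d + 1 : ℕ)) : (taylor r p - p).degree < d := by
  rcases eq_or_ne p 0 with rfl | h0
  · simp
  · have h0' : taylor r p ≠ 0 := by simpa using h0
    have hlt : (taylor r p - p).degree < (taylor r p).degree :=
      degree_sub_lt_left (degree_taylor p r) h0' (leadingCoeff_taylor r p)
    rw [degree_taylor, degree_eq_natDegree h0] at hlt
    rw [degree_eq_natDegree h0] at hp
    refine hlt.trans_le ?_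
    norm_cast at hp ⊢
    omega

theorem degree_C_mul_taylor_sub_C_mul_lt {p : K[X]} {d : WithBot ℕ} (r a b : K)
    (hp : p.degree < d) : (C a * taylor r p - C b * p).degree < d := by
  refine (degree_sub_le _ _).trans_lt (max_lt ?_ ?_)
  · refine lt_of_le_of_lt ?_ hp
    simpa [smul_eq_C_mul] using degree_smul_le a (taylor r p)
  · exact lt_of_le_of_lt (by simpa [smul_eq_C_mul] using degree_smul_le b p) hp

theorem eq_zero_of_C_mul_taylor_eq_C_mul {p : K[X]} {r a b : K} (hab : a ≠ b)
    (h : C a * taylor r p = C b * p) : p = 0 := by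
  have hc := congrArg (fun f : K[X] => f.coeff p.natDegree) h
  have ht : (taylor r p).coeff p.natDegree = p.leadingCoeff := by
    rw [← leadingCoeff_taylor r p, leadingCoeff, natDegree_taylor]
  simp only [coeff_C_mul, ht, coeff_natDegree] at hc
  by_contra h0
  exact hab (mul_right_cancel₀ (leadingCoeff_ne_zero.mpr h0) hc)

theorem eq_zero_of_taylor_one_eq_self [CharZero K] {p : K[X]} (h : taylor 1 p = p)
    (h0 : p.eval 0 = 0) : p = 0 := by
  have hn : ∀ n : ℕ, p.eval (n : K) = 0 := by
    intro n
    induction n with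
    | zero => simpa using h0
    | succ n ih => rw [Nat.cast_succ, ← taylor_eval, h, ih]
  refine eq_zero_of_infinite_isRoot p ((Set.infinite_range_of_injective
    (Nat.cast_injective (R := K))).mono ?_)
  rintro _ ⟨n, rfl⟩
  exact hn n

/-- An exponential polynomial `∑ pᵢ(ℓ) zᵢ ^ ℓ` with distinct nonzero nodes `zᵢ` and
`deg pᵢ < dᵢ` that vanishes at the first `∑ dᵢ` natural numbers has all its coefficients zero. -/
theorem eq_zero_of_sum_eval_mul_pow_eq_zero [CharZero K] {ι : Type*} (S : Finset ι) (z : ι → K)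
    (hz : Set.InjOn z S) (hz0 : ∀ i ∈ S, z i ≠ 0) (d : ι → ℕ) (p : ι → K[X])
    (hd : ∀ i ∈ S, (p i).degree < d i)
    (h : ∀ l : ℕ, l < ∑ i ∈ S, d i → ∑ i ∈ S, (p i).eval (l : K) * z i ^ l = 0) :
    ∀ i ∈ S, p i = 0 := by
  classical
  induction hn : ∑ i ∈ S, d i generalizing d p with
  | zero =>
    intro i hi
    have hdi : d i = 0 := Finset.sum_eq_zero_iff.mp hn i hi
    have := hd i hi
    rw [hdi] at this
    exact degree_eq_bot.mp (by simpa [Nat.WithBot.lt_zero_iff] using this)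
  | succ n ih =>
    obtain ⟨a, ha, hda⟩ : ∃ a ∈ S, d a ≠ 0 := by
      by_contra! hcon
      rw [Finset.sum_eq_zero hcon] at hn
      omega
    obtain ⟨e, he⟩ := Nat.exists_eq_succ_of_ne_zero hda
    have hsum : ∑ i ∈ S, Function.update d a e i = n := by
      rw [Finset.sum_update_of_mem ha]
      rw [← Finset.add_sum_erase S d ha, he] at hn
      rw [Finset.sdiff_singleton_eq_erase]
      omega
    have key : ∀ i ∈ S, C (z i) * taylor 1 (p i) - C (z a) * p i = 0 := by
      refine ih (Function.update d a e) _ ?_ ?_ hsum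
      · intro i hi
        rcases eq_or_ne i a with rfl | hia
        · rw [Function.update_self, ← mul_sub, degree_C_mul (hz0 i hi)]
          exact degree_taylor_sub_self_lt 1 (by simpa only [he] using hd i hi)
        · rw [Function.update_of_ne hia]
          exact degree_C_mul_taylor_sub_C_mul_lt 1 _ _ (hd i hi)
      · intro l hl
        have h₁ := h (l + 1) (by omega)
        have h₂ := h l (by omega)
        have : ∑ i ∈ S, (C (z i) * taylor 1 (p i) - C (z a) * p i).eval (l : K) * z i ^ l =
            ∑ i ∈ S, (p i).eval ((l + 1 : ℕ) : K) * z i ^ (l + 1) -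
              z a * ∑ i ∈ S, (p i).eval (l : K) * z i ^ l := by
          rw [Finset.mul_sum, ← Finset.sum_sub_distrib]
          refine Finset.sum_congr rfl fun i _ => ?_
          simp only [eval_sub, eval_mul, eval_C, taylor_eval, Nat.cast_succ]
          ring
        rw [this, h₁, h₂, mul_zero, sub_zero]
    have hne : ∀ i ∈ S, i ≠ a → p i = 0 := fun i hi hia =>
      eq_zero_of_C_mul_taylor_eq_C_mul (fun hza => hia (hz hi ha hza)) (sub_eq_zero.mp (key i hi))
    intro i hi
    rcases eq_or_ne i a with rfl | hia
    · refine eq_zero_of_taylor_one_eq_self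
        (mul_left_cancel₀ (C_ne_zero.mpr (hz0 i hi)) (sub_eq_zero.mp (key i hi))) ?_
      have h₀ := h 0 (by omega)
      rw [Finset.sum_eq_single_of_mem i hi fun j hj hji => by simp [hne j hj hji]] at h₀
      simpa using h₀
    · exact hne i hi hia

end Polynomial

theorem Complex.injOn_exp_two_pi_mul_I_Ico :
    Set.InjOn (fun γ : ℝ => Complex.exp (2 * (Real.pi : ℂ) * Complex.I * γ)) (Set.Ico 0 1) := by
  intro x hx y hy hxy
  obtain ⟨n, hn⟩ := Complex.exp_eq_exp_iff_exists_int.mp hxy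
  have hxn : x = y + n := by
    have : (2 * (Real.pi : ℂ) * Complex.I) * x = (2 * (Real.pi : ℂ) * Complex.I) * (y + n) := by
      rw [hn]; ring
    exact_mod_cast mul_left_cancel₀ Complex.two_pi_I_ne_zero this
  have h₁ : (n : ℝ) < 1 := by linarith [hx.2, hy.1]
  have h₂ : (-1 : ℝ) < n := by linarith [hx.1, hy.2]
  have h₀ : n = 0 := by
    have : n < 1 := by exact_mod_cast h₁
    have : -1 < n := by exact_mod_cast h₂
    omega
  simpa [h₀] using hxn

/-- An exponential sum `x(t) = Σ_{γ∈F} q_γ(t)e^{2πiγt}` with at most `æ`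
frequencies in `[0,1)` and nonzero polynomial coefficients of degree at most `M` is
completely determined by its samples at `0, 1, …, 2æ(M+1)−1`. -/
theorem statement_2 (ae M : ℕ) (hae : 1 ≤ ae)
    (F F' : Finset ℝ)
    (hF : ∀ γ ∈ F, γ ∈ Set.Ico (0 : ℝ) 1) (hF' : ∀ γ ∈ F', γ ∈ Set.Ico (0 : ℝ) 1)
    (hcard : F.card ≤ ae) (hcard' : F'.card ≤ ae)
    (q q' : ℝ → Polynomial ℂ)
    (hq : ∀ γ ∈ F, q γ ≠ 0) (hq' : ∀ γ ∈ F', q' γ ≠ 0)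
    (hdeg : ∀ γ ∈ F, (q γ).degree ≤ (M : ℕ)) (hdeg' : ∀ γ ∈ F', (q' γ).degree ≤ (M : ℕ))
    (hsamp : ∀ ℓ : ℕ, ℓ ≤ 2 * ae * (M + 1) - 1 →
      ∑ γ ∈ F, (q γ).eval ((ℓ : ℂ)) * Complex.exp (2 * (Real.pi : ℂ) * Complex.I * γ * ℓ) =
      ∑ γ ∈ F', (q' γ).eval ((ℓ : ℂ)) * Complex.exp (2 * (Real.pi : ℂ) * Complex.I * γ * ℓ)) :
    (∀ t : ℝ,
      ∑ γ ∈ F, (q γ).eval ((t : ℂ)) * Complex.exp (2 * (Real.pi : ℂ) * Complex.I * γ * t) =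
      ∑ γ ∈ F', (q' γ).eval ((t : ℂ)) * Complex.exp (2 * (Real.pi : ℂ) * Complex.I * γ * t)) ∧
    F = F' ∧ ∀ γ ∈ F, q γ = q' γ := by
  classical
  have hzero : ∀ γ ∈ F ∪ F',
      ((if γ ∈ F then q γ else 0) - if γ ∈ F' then q' γ else 0) = 0 := by
    refine eq_zero_of_sum_eval_mul_pow_eq_zero (F ∪ F')
      (fun γ : ℝ => Complex.exp (2 * (Real.pi : ℂ) * Complex.I * γ)) ?_
      (fun _ _ => Complex.exp_ne_zero _) (fun _ => M + 1) _ ?_ ?_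
    · refine Complex.injOn_exp_two_pi_mul_I_Ico.mono fun γ hγ => ?_
      exact (Finset.mem_union.mp (Finset.mem_coe.mp hγ)).elim (hF γ) (hF' γ)
    · have hM : (M : WithBot ℕ) < ((M + 1 : ℕ) : WithBot ℕ) := by exact_mod_cast M.lt_succ_self
      intro γ _
      refine lt_of_le_of_lt ((degree_sub_le _ _).trans (max_le ?_ ?_)) hM
      · split_ifs with hγ
        · exact hdeg γ hγ
        · simp
      · split_ifs with hγ
        · exact hdeg' γ hγ
        · simp
    · intro l hl
      rw [Finset.sum_const, smul_eq_mul] at hl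
      have hle : (F ∪ F').card * (M + 1) ≤ 2 * ae * (M + 1) :=
        Nat.mul_le_mul_right _ ((Finset.card_union_le F F').trans (by omega))
      have hs := hsamp l (by omega)
      have hpow : ∀ γ : ℝ, Complex.exp (2 * (Real.pi : ℂ) * Complex.I * γ) ^ l =
          Complex.exp (2 * (Real.pi : ℂ) * Complex.I * γ * l) := fun γ => by
        rw [← Complex.exp_nat_mul, mul_comm]
      simp only [hpow, eval_sub, sub_mul, Finset.sum_sub_distrib, apply_ite (eval (l : ℂ)),
        eval_zero, ite_mul, zero_mul, Finset.sum_ite_mem, Finset.union_inter_cancel_left,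
        Finset.union_inter_cancel_right, hs, sub_self]
  have hFF : F = F' := by
    ext γ
    constructor <;> intro hγ <;> by_contra hγ'
    · exact hq γ hγ (by simpa [hγ, hγ'] using hzero γ (Finset.mem_union_left _ hγ))
    · exact hq' γ hγ (by simpa [hγ, hγ'] using hzero γ (Finset.mem_union_right _ hγ))
  subst hFF
  have hqq : ∀ γ ∈ F, q γ = q' γ := fun γ hγ =>
    sub_eq_zero.mp (by simpa [hγ] using hzero γ (Finset.mem_union_left _ hγ))
  exact ⟨fun t => Finset.sum_congr rfl fun γ hγ => by rw [hqq γ hγ], rfl, hqq⟩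
end

section
/- Let s ≥ 1 be an integer. Let F and F′ be finite subsets of [0,1) with |F| ≤ s and |F′| ≤ s, and let (c_γ)_{γ∈F} and (c′_γ)_{γ∈F′} be families of nonzero complex numbers. Define x(t) = Σ_{γ∈F} c_γ e^{2πiγt} and y(t) = Σ_{γ∈F′} c′_γ e^{2πiγt} for t ∈ ℝ. If x(ℓ) = y(ℓ) for every integer ℓ with 0 ≤ ℓ ≤ 2s − 1, then F = F′ and c_γ = c′_γ for all γ ∈ F; in particular x = y on all of ℝ. -/
/-- Vandermonde nondegeneracy over a finset: a combination of powers of distinct nodes whose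
first `G.card` values vanish is trivial. -/
theorem Finset.eq_zero_of_forall_lt_card_sum_mul_pow_eq_zero {ι R : Type*} [CommRing R]
    [IsDomain R] {G : Finset ι} {v d : ι → R} (hv : Set.InjOn v G)
    (h : ∀ n < G.card, ∑ i ∈ G, d i * v i ^ n = 0) : ∀ i ∈ G, d i = 0 := by
  intro i hi
  let e := G.equivFin.symm
  have hz : (fun k => d (e k)) = 0 := by
    refine Matrix.eq_zero_of_forall_pow_sum_mul_pow_eq_zero (f := fun k => v (e k)) ?_ ?_
    · intro a b hab
      exact e.injective (Subtype.ext (hv (e a).2 (e b).2 hab))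
    · intro k
      rw [e.sum_comp (fun x : G => d x * v x ^ (k : ℕ)),
        Finset.sum_coe_sort G (fun x => d x * v x ^ (k : ℕ))]
      exact h k k.2
  simpa [e] using congrFun hz (G.equivFin ⟨i, hi⟩)

theorem Complex.injOn_exp_two_pi_I_mul_Ico :
    Set.InjOn (fun γ : ℝ => Complex.exp (2 * (Real.pi : ℂ) * Complex.I * γ))
      (Set.Ico (0 : ℝ) 1) := by
  intro a ha b hb hab
  obtain ⟨n, hn⟩ := Complex.exp_eq_exp_iff_exists_int.1 hab
  have hab' : (a : ℂ) = b + n := by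
    apply mul_left_cancel₀ Complex.two_pi_I_ne_zero
    linear_combination hn
  have hr : a = b + n := by exact_mod_cast hab'
  have h1 : n < 1 := by
    have : (n : ℝ) < 1 := by linarith [ha.2, hb.1]
    exact_mod_cast this
  have h2 : -1 < n := by
    have : (-1 : ℝ) < n := by linarith [ha.1, hb.2]
    exact_mod_cast this
  obtain rfl : n = 0 := by omega
  simpa using hr


/-- Standard off-grid Prony: a finite exponential sum
`x(t) = Σ_{γ∈F} c_γ e^{2πiγt}` with at most `s` frequencies in `[0,1)` and nonzero
coefficients is completely determined by its samples at `0, 1, …, 2s−1`. -/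
theorem statement_3 (s : ℕ) (hs : 1 ≤ s)
    (F F' : Finset ℝ)
    (hF : ∀ γ ∈ F, γ ∈ Set.Ico (0 : ℝ) 1) (hF' : ∀ γ ∈ F', γ ∈ Set.Ico (0 : ℝ) 1)
    (hcard : F.card ≤ s) (hcard' : F'.card ≤ s)
    (c c' : ℝ → ℂ)
    (hc : ∀ γ ∈ F, c γ ≠ 0) (hc' : ∀ γ ∈ F', c' γ ≠ 0)
    (hsamp : ∀ ℓ : ℕ, ℓ ≤ 2 * s - 1 →
      ∑ γ ∈ F, c γ * Complex.exp (2 * (Real.pi : ℂ) * Complex.I * γ * ℓ) =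
      ∑ γ ∈ F', c' γ * Complex.exp (2 * (Real.pi : ℂ) * Complex.I * γ * ℓ)) :
    F = F' ∧ (∀ γ ∈ F, c γ = c' γ) ∧
    ∀ t : ℝ,
      ∑ γ ∈ F, c γ * Complex.exp (2 * (Real.pi : ℂ) * Complex.I * γ * t) =
      ∑ γ ∈ F', c' γ * Complex.exp (2 * (Real.pi : ℂ) * Complex.I * γ * t) := by
  classical
  have hsum : ∀ f : ℝ → ℂ,
      ∑ γ ∈ F ∪ F', ((if γ ∈ F then c γ else 0) - (if γ ∈ F' then c' γ else 0)) * f γ =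
        ∑ γ ∈ F, c γ * f γ - ∑ γ ∈ F', c' γ * f γ := by
    intro f
    simp [sub_mul, ite_mul, Finset.sum_ite_mem, Finset.union_inter_cancel_left,
      Finset.union_inter_cancel_right]
  have hd := Finset.eq_zero_of_forall_lt_card_sum_mul_pow_eq_zero (G := F ∪ F')
    (v := fun γ : ℝ => Complex.exp (2 * (Real.pi : ℂ) * Complex.I * γ))
    (d := fun γ => (if γ ∈ F then c γ else 0) - (if γ ∈ F' then c' γ else 0))
    (Complex.injOn_exp_two_pi_I_mul_Ico.mono fun γ hγ =>
      (Finset.mem_union.1 hγ).elim (hF γ) (hF' γ))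
    (fun n hn => by
      have hle := Finset.card_union_le F F'
      have hn' := hsamp n (by omega)
      simp_rw [hsum, ← Complex.exp_nat_mul, mul_comm (n : ℂ)]
      exact sub_eq_zero.2 hn')
  have hFF' : F = F' := by
    ext γ
    constructor
    · intro h
      by_contra h'
      exact hc γ h (by simpa [h, h'] using hd γ (Finset.mem_union_left _ h))
    · intro h
      by_contra h'
      exact hc' γ h (by simpa [h, h'] using hd γ (Finset.mem_union_right _ h))
  subst hFF'
  have hcc' : ∀ γ ∈ F, c γ = c' γ := fun γ h =>
    sub_eq_zero.1 (by simpa [h] using hd γ (Finset.mem_union_left _ h))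
  exact ⟨rfl, hcc', fun t => Finset.sum_congr rfl fun γ h => by rw [hcc' γ h]⟩
end

section
/- Let d ≥ 1 and s ≥ 0 be integers with 2s ≤ d, and let k₀ be an integer. Let x, y ∈ ℂ^d be vectors each having at most s nonzero entries. For z ∈ ℂ^d define its Fourier coefficients ẑ(k) = Σ_{j=0}^{d−1} z_j e^{−2πijk/d} for k ∈ ℤ. If x̂(k) = ŷ(k) for all integers k with k₀ ≤ k ≤ k₀ + 2s − 1, then x = y. -/
open scoped Classical

/-- A finite combination of at most `n` geometric sequences with distinct ratios that vanishes at
`0, …, n - 1` has only zero coefficients. -/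
theorem eq_zero_of_sum_mul_pow_eq_zero {ι R : Type*} [CommRing R] [IsDomain R] {S : Finset ι}
    {c v : ι → R} (hv : Set.InjOn v S) {n : ℕ} (hn : S.card ≤ n)
    (h : ∀ m < n, ∑ j ∈ S, c j * v j ^ m = 0) {i : ι} (hi : i ∈ S) : c i = 0 := by
  let p : Polynomial R := ∏ j ∈ S.erase i, (Polynomial.X - Polynomial.C (v j))
  have hdeg : p.natDegree < n := by
    have hcard := Finset.card_erase_lt_of_mem hi
    rw [Polynomial.natDegree_finsetProd_X_sub_C_eq_card]
    omega
  have hsum : ∑ j ∈ S, c j * p.eval (v j) = 0 := by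
    simp_rw [Polynomial.eval_eq_sum_range' hdeg, Finset.mul_sum]
    rw [Finset.sum_comm]
    refine Finset.sum_eq_zero fun m hm => ?_
    simp_rw [mul_left_comm (c _)]
    rw [← Finset.mul_sum, h m (Finset.mem_range.mp hm), mul_zero]
  rw [Finset.sum_eq_single_of_mem i hi fun j hj hji => ?_] at hsum
  · refine (mul_eq_zero.mp hsum).resolve_right ?_
    rw [Polynomial.eval_prod, ← ne_eq, Finset.prod_ne_zero_iff]
    intro j hj
    obtain ⟨hji, hj⟩ := Finset.mem_erase.mp hj
    simpa [sub_eq_zero] using fun e => hji (hv hj hi e.symm)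
  · rw [Polynomial.eval_prod,
      Finset.prod_eq_zero (Finset.mem_erase.mpr ⟨hji, hj⟩) (by simp), mul_zero]

theorem injective_exp_neg_two_pi_I_mul_div {d : ℕ} (hd : d ≠ 0) :
    Function.Injective fun j : Fin d =>
      Complex.exp (-(2 * (Real.pi : ℂ) * Complex.I * ((j : ℕ) : ℂ)) / d) := by
  intro a b hab
  have hpow (j : Fin d) : Complex.exp (-(2 * (Real.pi : ℂ) * Complex.I * ((j : ℕ) : ℂ)) / d) =
      (Complex.exp (2 * Real.pi * Complex.I / d))⁻¹ ^ (j : ℕ) := by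
    rw [← Complex.exp_neg, ← Complex.exp_nat_mul]
    ring_nf
  simp only [hpow] at hab
  exact Fin.ext ((Complex.isPrimitiveRoot_exp d hd).inv.pow_inj a.isLt b.isLt hab)

/-- Prony's classical theorem: an `s`-sparse vector in `ℂ^d` (with
`2s ≤ d`) is uniquely determined by any `2s` consecutive discrete Fourier
coefficients `ẑ(k) = Σ_{j=0}^{d−1} z_j e^{−2πijk/d}`, `k = k₀, …, k₀+2s−1`. -/
theorem statement_4 (d s : ℕ) (hd : 1 ≤ d) (hs : 2 * s ≤ d) (k₀ : ℤ)
    (x y : Fin d → ℂ)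
    (hx : (Finset.univ.filter fun j => x j ≠ 0).card ≤ s)
    (hy : (Finset.univ.filter fun j => y j ≠ 0).card ≤ s)
    (hsamp : ∀ k : ℤ, k₀ ≤ k → k ≤ k₀ + 2 * s - 1 →
      ∑ j : Fin d, x j *
          Complex.exp (-(2 * (Real.pi : ℂ) * Complex.I * ((j : ℕ) : ℂ) * (k : ℂ)) / d) =
      ∑ j : Fin d, y j *
          Complex.exp (-(2 * (Real.pi : ℂ) * Complex.I * ((j : ℕ) : ℂ) * (k : ℂ)) / d)) :
    x = y := by
  let S := Finset.univ.filter fun j => x j - y j ≠ 0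
  have hS : S.card ≤ 2 * s := by
    have hsub : S ⊆ (Finset.univ.filter fun j => x j ≠ 0) ∪
        (Finset.univ.filter fun j => y j ≠ 0) := by
      intro j hj
      simp only [S, Finset.mem_union, Finset.mem_filter_univ] at hj ⊢
      contrapose! hj
      simp [hj.1, hj.2]
    have hcard := (Finset.card_le_card hsub).trans (Finset.card_union_le _ _)
    omega
  have hzero (m : ℕ) (hm : m < 2 * s) :
      ∑ j ∈ S, ((x j - y j) *
          Complex.exp (-(2 * (Real.pi : ℂ) * Complex.I * ((j : ℕ) : ℂ) * (k₀ : ℂ)) / d)) *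
        Complex.exp (-(2 * (Real.pi : ℂ) * Complex.I * ((j : ℕ) : ℂ)) / d) ^ m = 0 := by
    rw [Finset.sum_subset (Finset.subset_univ S) fun j _ hj => ?_]
    · have hk := sub_eq_zero.mpr (hsamp (k₀ + m) (by omega) (by omega))
      rw [← Finset.sum_sub_distrib] at hk
      rw [← hk]
      refine Finset.sum_congr rfl fun j _ => ?_
      rw [mul_assoc, ← Complex.exp_nat_mul, ← Complex.exp_add, ← sub_mul]
      push_cast
      ring_nf
    · have hj : x j - y j = 0 := by simpa [S] using hj
      simp [hj]
  funext i
  by_contra hi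
  have hi : x i - y i ≠ 0 := sub_ne_zero.mpr hi
  have hmem : i ∈ S := by simpa [S] using hi
  have hinj := (injective_exp_neg_two_pi_I_mul_div (d := d) (by omega)).injOn (s := ↑S)
  exact mul_ne_zero hi (Complex.exp_ne_zero _)
    (eq_zero_of_sum_mul_pow_eq_zero hinj hS hzero hmem)
end

section
/- Let X be a complex vector space, S ≥ 1 an integer, B : X → X a linear map, and A : X → ℂ^S a linear map. Let Ω be a set, h : Ω → ℂ an injective function with h(γ) ≠ 0 for all γ ∈ Ω, and (x_γ)_{γ∈Ω} a family of vectors in X satisfying B x_γ = h(γ)·x_γ and A x_γ ≠ 0 for every γ ∈ Ω. Let æ ≥ 1, let F, F′ ⊆ Ω be finite sets with |F| ≤ æ and |F′| ≤ æ, let (c_γ)_{γ∈F} and (c′_γ)_{γ∈F′} be families of nonzero complex scalars, and set x = Σ_{γ∈F} c_γ x_γ and x′ = Σ_{γ∈F′} c′_γ x_γ. If A(B^ℓ x) = A(B^ℓ x′) for every integer ℓ with 0 ≤ ℓ ≤ 2æ − 1, then F = F′. -/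
/-- Vandermonde-type uniqueness with vector coefficients: if the first `n` power moments of a
family of vectors at at most `n` distinct nodes vanish, then the vectors vanish. -/
theorem eq_zero_of_sum_pow_smul_eq_zero {K M ι : Type*} [Field K] [AddCommGroup M] [Module K M]
    {s : Finset ι} {a : ι → K} (ha : Set.InjOn a s) {n : ℕ} (hn : s.card ≤ n) {v : ι → M}
    (hv : ∀ l < n, ∑ i ∈ s, a i ^ l • v i = 0) {i : ι} (hi : i ∈ s) : v i = 0 := by
  classical
  have hpoly (p : Polynomial K) (hp : p.natDegree < n) : ∑ j ∈ s, p.eval (a j) • v j = 0 := by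
    simp_rw [Polynomial.eval_eq_sum_range' hp, Finset.sum_smul, mul_smul]
    rw [Finset.sum_comm]
    refine Finset.sum_eq_zero fun l hl => ?_
    rw [← Finset.smul_sum, hv l (Finset.mem_range.mp hl), smul_zero]
  have hdeg : (Lagrange.basis s a i).natDegree < n := by
    have hpos : 0 < s.card := Finset.card_pos.mpr ⟨i, hi⟩
    have := Polynomial.natDegree_eq_of_degree_eq_some (Lagrange.degree_basis ha hi)
    omega
  have hsum := hpoly _ hdeg
  rw [Finset.sum_eq_single_of_mem i hi fun j hj hji => by
    rw [Lagrange.eval_basis_of_ne hji.symm hj, zero_smul]] at hsum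
  simpa [Lagrange.eval_basis_self ha hi] using hsum

/-- Powers of an endomorphism act on eigenvectors through powers of the eigenvalue. -/
theorem Module.End.pow_apply_of_apply_eq_smul {R M : Type*} [CommSemiring R] [AddCommMonoid M]
    [Module R M] {f : Module.End R M} {r : R} {x : M} (hx : f x = r • x) (l : ℕ) :
    (f ^ l) x = r ^ l • x := by
  induction l with
  | zero => simp
  | succ l ih => rw [pow_succ', Module.End.mul_apply, ih, map_smul, hx, smul_smul, pow_succ]

/-- Abstract Prony with one-dimensional eigenspaces: if the `x_γ` are
eigenvectors of `B` with pairwise distinct nonzero eigenvalues `h(γ)` and none of them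
is annihilated by the measurement map `A`, then the support `F` of the signal
`x = Σ_{γ∈F} c_γ x_γ` is determined by the `2æ` measurements `A B^ℓ x`, `ℓ = 0,…,2æ−1`. -/
theorem statement_5 (X : Type*) [AddCommGroup X] [Module ℂ X]
    (S : ℕ) (hS : 1 ≤ S)
    (B : Module.End ℂ X) (A : X →ₗ[ℂ] (Fin S → ℂ))
    (Ω : Type*) (h : Ω → ℂ) (hinj : Function.Injective h) (hne : ∀ γ, h γ ≠ 0)
    (xv : Ω → X) (heig : ∀ γ, B (xv γ) = h γ • xv γ) (hA : ∀ γ, A (xv γ) ≠ 0)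
    (ae : ℕ) (hae : 1 ≤ ae)
    (F F' : Finset Ω) (hF : F.card ≤ ae) (hF' : F'.card ≤ ae)
    (c c' : Ω → ℂ) (hc : ∀ γ ∈ F, c γ ≠ 0) (hc' : ∀ γ ∈ F', c' γ ≠ 0)
    (hmeas : ∀ ℓ : ℕ, ℓ ≤ 2 * ae - 1 →
      A ((B ^ ℓ) (∑ γ ∈ F, c γ • xv γ)) = A ((B ^ ℓ) (∑ γ ∈ F', c' γ • xv γ))) :
    F = F' := by
  classical
  set d : Ω → ℂ := fun γ => (if γ ∈ F then c γ else 0) - (if γ ∈ F' then c' γ else 0) with hd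
  have hcard : (F ∪ F').card ≤ 2 * ae := (Finset.card_union_le F F').trans (by omega)
  have hdiff : ∑ γ ∈ F ∪ F', d γ • xv γ =
      ∑ γ ∈ F, c γ • xv γ - ∑ γ ∈ F', c' γ • xv γ := by
    simp only [hd, sub_smul, ite_smul, zero_smul, Finset.sum_sub_distrib, Finset.sum_ite_mem,
      Finset.union_inter_cancel_left, Finset.union_inter_cancel_right]
  have hmoment (l : ℕ) (hl : l < 2 * ae) :
      ∑ γ ∈ F ∪ F', h γ ^ l • d γ • A (xv γ) = 0 := by
    calc ∑ γ ∈ F ∪ F', h γ ^ l • d γ • A (xv γ)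
        = A ((B ^ l) (∑ γ ∈ F ∪ F', d γ • xv γ)) := by
          simp only [map_sum, map_smul, Module.End.pow_apply_of_apply_eq_smul (heig _)]
          exact Finset.sum_congr rfl fun γ _ => smul_comm _ _ _
      _ = 0 := by
          rw [hdiff, map_sub, map_sub, hmeas l (by omega), sub_self]
  have hzero (γ : Ω) (hγ : γ ∈ F ∪ F') : d γ = 0 :=
    (smul_eq_zero.mp (eq_zero_of_sum_pow_smul_eq_zero hinj.injOn hcard hmoment hγ)).resolve_right
      (hA γ)
  ext γ
  constructor
  · intro hγ
    by_contra hγ'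
    exact hc γ hγ (by simpa [hd, hγ, hγ'] using hzero γ (Finset.mem_union_left _ hγ))
  · intro hγ
    by_contra hγ'
    exact hc' γ hγ (by simpa [hd, hγ, hγ'] using hzero γ (Finset.mem_union_right _ hγ))
end

section
/- Let X be a complex vector space, S ≥ 1 an integer, B : X → X a linear map, and A : X → ℂ^S a linear map. Let F be a nonempty finite index set, (λ_γ)_{γ∈F} pairwise distinct nonzero complex numbers, (x_γ)_{γ∈F} vectors with B x_γ = λ_γ x_γ and A x_γ ≠ 0, and (c_γ)_{γ∈F} nonzero complex scalars; set x = Σ_{γ∈F} c_γ x_γ. Then: (i) for every complex polynomial p satisfying A(p(B)(B^k x)) = 0 for all integers k ≥ 0, one has p(λ_γ) = 0 for every γ ∈ F; and (ii) the polynomial q(z) = Π_{γ∈F}(z − λ_γ) satisfies A(q(B)(B^k x)) = 0 for all k ≥ 0. Consequently, the monic polynomial of minimal degree p satisfying A(p(B)(B^k x)) = 0 for all k ≥ 0 is exactly Π_{γ∈F}(z − λ_γ), and its set of roots equals {λ_γ : γ ∈ F}. -/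
open Polynomial

/-- If `B v = μ • v`, then `p(B) v = p(μ) • v`. -/
theorem aeval_apply_of_apply_eq_smul {R M : Type*} [CommRing R] [AddCommGroup M] [Module R M]
    {B : Module.End R M} {μ : R} {v : M} (hv : B v = μ • v) (p : R[X]) :
    aeval B p v = p.eval μ • v := by
  rcases eq_or_ne v 0 with rfl | h0
  · simp
  · exact Module.End.aeval_apply_of_hasEigenvector ⟨Module.End.mem_eigenspace_iff.2 hv, h0⟩

/-- If `v i` are eigenvectors of `B`, then `p(B)` acts on their span diagonally. -/
theorem aeval_sum_smul_eigenvectors {R M ι : Type*} [CommRing R] [AddCommGroup M] [Module R M]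
    (B : Module.End R M) (s : Finset ι) (μ c : ι → R) (v : ι → M)
    (hv : ∀ i ∈ s, B (v i) = μ i • v i) (p : R[X]) :
    aeval B p (∑ i ∈ s, c i • v i) = ∑ i ∈ s, (c i * p.eval (μ i)) • v i := by
  rw [map_sum]
  refine Finset.sum_congr rfl fun i hi => ?_
  rw [map_smul, aeval_apply_of_apply_eq_smul (hv i hi), smul_smul]

/-- Annihilating `p(B) B ^ k x` for all `k` amounts to annihilating `(p * r)(B) x` for all `r`. -/
theorem map_aeval_mul_eq_zero {R M N : Type*} [CommRing R] [AddCommGroup M] [Module R M]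
    [AddCommGroup N] [Module R N] {B : Module.End R M} {A : M →ₗ[R] N} {x : M} {p : R[X]}
    (h : ∀ k : ℕ, A (aeval B p ((B ^ k) x)) = 0) (r : R[X]) :
    A (aeval B (p * r) x) = 0 := by
  induction r using Polynomial.induction_on' with
  | add r₁ r₂ h₁ h₂ => rw [mul_add, map_add, LinearMap.add_apply, map_add, h₁, h₂, add_zero]
  | monomial n a =>
    rw [← C_mul_X_pow_eq_monomial, mul_left_comm, ← smul_eq_C_mul, map_smul,
      LinearMap.smul_apply, map_smul, map_mul, aeval_X_pow, Module.End.mul_apply, h, smul_zero]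

/-- The product of `X - C (μ i)` over distinct `μ i` divides any polynomial vanishing
at all `μ i`. -/
theorem prod_X_sub_C_dvd_of_eval_eq_zero {K ι : Type*} [Field K] {s : Finset ι} {μ : ι → K}
    (hμ : Set.InjOn μ s) {p : K[X]} (h : ∀ i ∈ s, p.eval (μ i) = 0) :
    ∏ i ∈ s, (X - C (μ i)) ∣ p :=
  Finset.prod_dvd_of_coprime
    (fun _ hi _ hj hij => isCoprime_X_sub_C_of_isUnit_sub
      (sub_ne_zero.2 fun e => hij (hμ hi hj e)).isUnit)
    fun i hi => dvd_iff_isRoot.2 (h i hi)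

/-- identification of the annihilating polynomial in the abstract Prony
method: (i) every polynomial `p` with `A(p(B)B^k x) = 0` for all `k ≥ 0` vanishes at all
eigenvalues `λ_γ`, `γ ∈ F`; (ii) `q(z) = Π_{γ∈F}(z−λ_γ)` is such an annihilator; and
consequently (iii) the monic annihilator of minimal degree is exactly
`Π_{γ∈F}(z−λ_γ)`, whose root set is `{λ_γ : γ ∈ F}`. -/
theorem statement_6 (X : Type*) [AddCommGroup X] [Module ℂ X]
    (S : ℕ) (hS : 1 ≤ S)
    (B : Module.End ℂ X) (A : X →ₗ[ℂ] (Fin S → ℂ))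
    (Ω : Type*) (F : Finset Ω) (hFne : F.Nonempty)
    (lam : Ω → ℂ) (hinj : Set.InjOn lam (F : Set Ω)) (hne : ∀ γ ∈ F, lam γ ≠ 0)
    (xv : Ω → X) (heig : ∀ γ ∈ F, B (xv γ) = lam γ • xv γ) (hA : ∀ γ ∈ F, A (xv γ) ≠ 0)
    (c : Ω → ℂ) (hc : ∀ γ ∈ F, c γ ≠ 0)
    (x : X) (hx : x = ∑ γ ∈ F, c γ • xv γ) :
    (∀ p : Polynomial ℂ,
      (∀ k : ℕ, A ((Polynomial.aeval B p) ((B ^ k) x)) = 0) →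
      ∀ γ ∈ F, p.eval (lam γ) = 0) ∧
    (∀ k : ℕ,
      A ((Polynomial.aeval B (∏ γ ∈ F, (Polynomial.X - Polynomial.C (lam γ)))) ((B ^ k) x))
        = 0) ∧
    (∀ p : Polynomial ℂ, p.Monic →
      (∀ k : ℕ, A ((Polynomial.aeval B p) ((B ^ k) x)) = 0) →
      (∀ p' : Polynomial ℂ, p'.Monic →
        (∀ k : ℕ, A ((Polynomial.aeval B p') ((B ^ k) x)) = 0) →
        p.natDegree ≤ p'.natDegree) →
      p = ∏ γ ∈ F, (Polynomial.X - Polynomial.C (lam γ)) ∧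
        {z : ℂ | p.eval z = 0} = ↑(F.image lam)) := by
  classical
  have hroots : ∀ p : Polynomial ℂ,
      (∀ k : ℕ, A ((Polynomial.aeval B p) ((B ^ k) x)) = 0) →
      ∀ γ ∈ F, p.eval (lam γ) = 0 := by
    intro p hp γ hγ
    set r : ℂ[X] := ∏ δ ∈ F.erase γ, (Polynomial.X - Polynomial.C (lam δ)) with hr
    have hrγ : r.eval (lam γ) ≠ 0 := by
      rw [hr, eval_prod, Finset.prod_ne_zero_iff]
      intro δ hδ
      rw [Finset.mem_erase] at hδ
      rw [eval_sub, eval_X, eval_C, sub_ne_zero]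
      exact fun e => hδ.1 (hinj hδ.2 hγ e.symm)
    have hrδ : ∀ δ ∈ F, δ ≠ γ → r.eval (lam δ) = 0 := by
      intro δ hδ hne'
      rw [hr, eval_prod]
      exact Finset.prod_eq_zero (Finset.mem_erase.2 ⟨hne', hδ⟩) (by simp)
    have h := map_aeval_mul_eq_zero hp r
    rw [hx, aeval_sum_smul_eigenvectors B F lam c xv heig, Finset.sum_eq_single_of_mem γ hγ
      (fun δ hδ hne' => by rw [eval_mul, hrδ δ hδ hne', mul_zero, mul_zero, zero_smul]),
      map_smul, eval_mul] at h
    simpa [hc γ hγ, hrγ, hA γ hγ] using h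
  have hann : ∀ k : ℕ,
      A ((Polynomial.aeval B (∏ γ ∈ F, (Polynomial.X - Polynomial.C (lam γ)))) ((B ^ k) x))
        = 0 := by
    intro k
    rw [← aeval_X_pow (R := ℂ) B, ← Module.End.mul_apply, ← map_mul, hx,
      aeval_sum_smul_eigenvectors B F lam c xv heig, Finset.sum_eq_zero, map_zero]
    intro γ hγ
    rw [eval_mul, eval_prod, Finset.prod_eq_zero hγ (by simp), zero_mul, mul_zero, zero_smul]
  refine ⟨hroots, hann, fun p hpm hp hmin => ?_⟩
  have hqm : (∏ γ ∈ F, (Polynomial.X - Polynomial.C (lam γ))).Monic :=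
    monic_prod_X_sub_C lam F
  have hpq : p = ∏ γ ∈ F, (Polynomial.X - Polynomial.C (lam γ)) :=
    (eq_of_monic_of_dvd_of_natDegree_le hqm hpm
      (prod_X_sub_C_dvd_of_eval_eq_zero hinj (hroots p hp)) (hmin _ hqm hann))
  refine ⟨hpq, ?_⟩
  ext z
  simp [hpq, eval_prod, Finset.prod_eq_zero_iff, sub_eq_zero, eq_comm (a := z)]
end

section
/- Let X be a complex normed vector space, S ≥ 1 an integer, B : X → X a continuous linear operator, and A : X → ℂ^S a continuous linear map. Let x ∈ X and let p be a complex polynomial such that A(p(B)(B^k x)) = 0 for all integers k ≥ 0. Suppose v belongs to the closure of the linear span of {B^k x : k ≥ 0}, that B v = μ·v for some μ ∈ ℂ, and that A v ≠ 0. Then p(μ) = 0. -/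
open Polynomial

theorem ContinuousLinearMap.aeval_apply_of_apply_eq_smul {𝕜 X : Type*} [NormedField 𝕜]
    [SeminormedAddCommGroup X] [NormedSpace 𝕜 X] {B : X →L[𝕜] X} {v : X} {μ : 𝕜}
    (h : B v = μ • v) (p : Polynomial 𝕜) : (Polynomial.aeval B p) v = p.eval μ • v := by
  have hpow (n : ℕ) : (B ^ n) v = μ ^ n • v := by
    induction n with
    | zero => simp
    | succ n ih =>
      rw [pow_succ, mul_apply_eq_comp, h, map_smul, ih, smul_smul, pow_succ']
  induction p using Polynomial.induction_on' with
  | add p q hp hq => simp [hp, hq, add_smul]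
  | monomial n a =>
    simp [Polynomial.aeval_monomial, Algebra.algebraMap_eq_smul_one, hpow, smul_smul]

/-- observability criterion: if `A(p(B)(B^k x)) = 0` for all `k ≥ 0`, and
`v` is an eigenvector of `B` with eigenvalue `μ` lying in the closure of the Krylov
subspace `span{B^k x : k ≥ 0}` with `A v ≠ 0`, then `p(μ) = 0`. -/
theorem statement_7 (X : Type*) [NormedAddCommGroup X] [NormedSpace ℂ X]
    (S : ℕ) (hS : 1 ≤ S)
    (B : X →L[ℂ] X) (A : X →L[ℂ] (Fin S → ℂ))
    (x : X) (p : Polynomial ℂ)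
    (hp : ∀ k : ℕ, A ((Polynomial.aeval B p) ((B ^ k) x)) = 0)
    (v : X) (hv : v ∈ closure (Submodule.span ℂ (Set.range fun k : ℕ => (B ^ k) x) : Set X))
    (μ : ℂ) (heig : B v = μ • v) (hAv : A v ≠ 0) :
    p.eval μ = 0 := by
  have hker : Submodule.span ℂ (Set.range fun k : ℕ => (B ^ k) x) ≤
      (A.comp (Polynomial.aeval B p)).ker := by
    rw [Submodule.span_le]
    rintro _ ⟨k, rfl⟩
    exact hp k
  have hv0 : A ((Polynomial.aeval B p) v) = 0 :=
    closure_minimal hker (A.comp (Polynomial.aeval B p)).isClosed_ker hv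
  rw [ContinuousLinearMap.aeval_apply_of_apply_eq_smul heig, map_smul] at hv0
  exact (smul_eq_zero.mp hv0).resolve_right hAv
end

section
/- Let X be a finite-dimensional complex vector space, S ≥ 1 an integer, B : X → X a linear map, A : X → ℂ^S a linear map, and x ∈ X. Let K denote the linear span of {B^k x : k ≥ 0}, which is a B-invariant subspace of X. Let p be a monic complex polynomial of minimal degree among all monic polynomials q satisfying A(q(B)(B^k x)) = 0 for all integers k ≥ 0. Then every nonzero root of p is an eigenvalue of the restriction of B to K. -/
open Polynomial

/-- finite-dimensional form of "R_min ⊆ σ(B_F)": every nonzero root of the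
minimal monic `(A,B,x)`-annihilator is an eigenvalue of the restriction of `B` to the
(`B`-invariant) Krylov subspace `K = span{B^k x : k ≥ 0}`. -/
theorem statement_8 (X : Type*) [AddCommGroup X] [Module ℂ X] [FiniteDimensional ℂ X]
    (S : ℕ) (hS : 1 ≤ S)
    (B : Module.End ℂ X) (A : X →ₗ[ℂ] (Fin S → ℂ)) (x : X)
    (K : Submodule ℂ X) (hK : K = Submodule.span ℂ (Set.range fun k : ℕ => (B ^ k) x))
    (hKinv : ∀ v ∈ K, B v ∈ K)
    (p : Polynomial ℂ) (hmonic : p.Monic)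
    (hp : ∀ k : ℕ, A ((Polynomial.aeval B p) ((B ^ k) x)) = 0)
    (hmin : ∀ q : Polynomial ℂ, q.Monic →
      (∀ k : ℕ, A ((Polynomial.aeval B q) ((B ^ k) x)) = 0) →
      p.natDegree ≤ q.natDegree) :
    ∀ z : ℂ, z ≠ 0 → p.eval z = 0 →
      Module.End.HasEigenvalue (B.restrict hKinv) z := by
  intro z _ hz
  by_contra hne
  have hker : LinearMap.ker (B.restrict hKinv - z • (1 : Module.End ℂ K)) = ⊥ := by
    rw [← Module.End.eigenspace_def]
    by_contra h
    exact hne (Module.End.hasEigenvalue_iff.mpr h)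
  have hsurj := LinearMap.injective_iff_surjective.mp (LinearMap.ker_eq_bot.mp hker)
  have hpK : ∀ w ∈ K, A (aeval B p w) = 0 := by
    have hle : K ≤ LinearMap.ker (A ∘ₗ aeval B p) := by
      rw [hK, Submodule.span_le]
      rintro _ ⟨k, rfl⟩
      exact hp k
    exact fun w hw => hle hw
  obtain ⟨q, rfl⟩ := dvd_iff_isRoot.mpr hz
  have hq : q.Monic := (monic_X_sub_C z).of_mul_monic_left hmonic
  have hdeg := hmin q hq fun k => by
    have hk : (B ^ k) x ∈ K := hK ▸ Submodule.subset_span ⟨k, rfl⟩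
    obtain ⟨w, hw⟩ := hsurj ⟨_, hk⟩
    have hw' : B w - z • (w : X) = (B ^ k) x := by
      simpa using congrArg Subtype.val hw
    have h := hpK w w.2
    rw [mul_comm, map_mul] at h
    rw [← hw']
    simpa using h
  rw [(monic_X_sub_C z).natDegree_mul hq, natDegree_X_sub_C] at hdeg
  omega
end

section
/- Define h : ℝ² → ℂ by h(t,ν) = e^{2πit/12} + i·e^{−2πiν/12}. Then h is injective on the square [0,1)²: if t, t′, ν, ν′ ∈ [0,1) satisfy h(t,ν) = h(t′,ν′), then t = t′ and ν = ν′. -/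
theorem Real.strictMonoOn_sin_add_cos :
    StrictMonoOn (fun x : ℝ => Real.sin x + Real.cos x) (Set.Icc 0 (Real.pi / 4)) := by
  intro x hx y hy hxy
  have hsin : Real.sin (x + Real.pi / 4) < Real.sin (y + Real.pi / 4) :=
    Real.strictMonoOn_sin ⟨by linarith [hx.1, Real.pi_pos], by linarith [hx.2]⟩
      ⟨by linarith [hy.1, Real.pi_pos], by linarith [hy.2]⟩ (by linarith)
  simp only [Real.sin_add, Real.cos_pi_div_four, Real.sin_pi_div_four, ← add_mul] at hsin
  exact lt_of_mul_lt_mul_right hsin (by positivity)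

theorem not_lt_of_cos_add_sin_eq {a a' b b' : ℝ}
    (ha : a ∈ Set.Icc 0 (Real.pi / 4)) (ha' : a' ∈ Set.Icc 0 (Real.pi / 4))
    (hb : b ∈ Set.Icc 0 (Real.pi / 4)) (hb' : b' ∈ Set.Icc 0 (Real.pi / 4))
    (hre : Real.cos a + Real.sin b = Real.cos a' + Real.sin b')
    (him : Real.sin a + Real.cos b = Real.sin a' + Real.cos b') : ¬ a < a' := by
  intro h
  have hcos : Real.cos a' < Real.cos a :=
    Real.strictAntiOn_cos ⟨ha.1, by linarith [ha.2, Real.pi_pos]⟩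
      ⟨ha'.1, by linarith [ha'.2, Real.pi_pos]⟩ h
  have hbb : b < b' := by
    by_contra! hle
    have := Real.strictMonoOn_sin.monotoneOn
      (⟨by linarith [hb'.1, Real.pi_pos], by linarith [hb'.2, Real.pi_pos]⟩ :
        b' ∈ Set.Icc (-(Real.pi / 2)) (Real.pi / 2))
      ⟨by linarith [hb.1, Real.pi_pos], by linarith [hb.2, Real.pi_pos]⟩ hle
    linarith
  have h₁ := Real.strictMonoOn_sin_add_cos ha ha' h
  have h₂ := Real.strictMonoOn_sin_add_cos hb hb' hbb
  dsimp only at h₁ h₂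
  linarith

theorem exp_add_I_mul_exp_eq (t ν : ℝ) :
    Complex.exp (2 * (Real.pi : ℂ) * Complex.I * t / 12) +
        Complex.I * Complex.exp (-(2 * (Real.pi : ℂ) * Complex.I * ν) / 12) =
      ⟨Real.cos (Real.pi * t / 6) + Real.sin (Real.pi * ν / 6),
        Real.sin (Real.pi * t / 6) + Real.cos (Real.pi * ν / 6)⟩ := by
  have h₁ : 2 * (Real.pi : ℂ) * Complex.I * t / 12 =
      ((Real.pi * t / 6 : ℝ) : ℂ) * Complex.I := by push_cast; ring
  have h₂ : -(2 * (Real.pi : ℂ) * Complex.I * ν) / 12 =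
      ((-(Real.pi * ν / 6) : ℝ) : ℂ) * Complex.I := by push_cast; ring
  rw [h₁, h₂]
  apply Complex.ext <;>
    simp only [Complex.add_re, Complex.add_im, Complex.I_mul_re, Complex.I_mul_im,
      Complex.exp_ofReal_mul_I_re, Complex.exp_ofReal_mul_I_im, Real.sin_neg, Real.cos_neg,
      neg_neg]

/-- the function `h(t,ν) = e^{2πit/12} + i·e^{−2πiν/12}` is injective on
the square `[0,1)²`. -/
theorem statement_11 (t t' ν ν' : ℝ)
    (ht : t ∈ Set.Ico (0 : ℝ) 1) (ht' : t' ∈ Set.Ico (0 : ℝ) 1)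
    (hν : ν ∈ Set.Ico (0 : ℝ) 1) (hν' : ν' ∈ Set.Ico (0 : ℝ) 1)
    (heq : Complex.exp (2 * (Real.pi : ℂ) * Complex.I * t / 12) +
        Complex.I * Complex.exp (-(2 * (Real.pi : ℂ) * Complex.I * ν) / 12) =
      Complex.exp (2 * (Real.pi : ℂ) * Complex.I * t' / 12) +
        Complex.I * Complex.exp (-(2 * (Real.pi : ℂ) * Complex.I * ν') / 12)) :
    t = t' ∧ ν = ν' := by
  rw [exp_add_I_mul_exp_eq, exp_add_I_mul_exp_eq, Complex.mk.injEq] at heq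
  obtain ⟨hre, him⟩ := heq
  have hmem : ∀ x ∈ Set.Ico (0 : ℝ) 1, Real.pi * x / 6 ∈ Set.Icc 0 (Real.pi / 4) := by
    rintro x ⟨h0, h1⟩
    exact ⟨by positivity, by nlinarith [Real.pi_pos]⟩
  have hinj : ∀ x y : ℝ, Real.pi * x / 6 = Real.pi * y / 6 → x = y := by
    intro x y h
    exact mul_left_cancel₀ Real.pi_ne_zero (by linarith)
  have ha := hmem t ht
  have ha' := hmem t' ht'
  have hb := hmem ν hν
  have hb' := hmem ν' hν'
  refine ⟨hinj _ _ (le_antisymm ?_ ?_), hinj _ _ (le_antisymm ?_ ?_)⟩ <;> refine not_lt.mp ?_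
  · exact not_lt_of_cos_add_sin_eq ha' ha hb' hb hre.symm him.symm
  · exact not_lt_of_cos_add_sin_eq ha ha' hb hb' hre him
  · exact not_lt_of_cos_add_sin_eq hb' hb ha' ha (by linarith) (by linarith)
  · exact not_lt_of_cos_add_sin_eq hb hb' ha ha' (by linarith) (by linarith)
end

section
/- Define h : ℝ² → ℂ by h(t,ν) = e^{2πit/12} + i·e^{−2πiν/12}. Then for every (t,ν) ∈ [0,1)², writing h(t,ν) = x + iy with x, y ∈ ℝ, one has t = (3/π)·(arcsin((x² + y² − 2)/2) − arcsin((x² − y²)/(x² + y²))) and ν = (3/π)·(arcsin((x² + y² − 2)/2) + arcsin((x² − y²)/(x² + y²))). -/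
theorem sq_add_sq_cos_add_sin (a b : ℝ) :
    (Real.cos a + Real.sin b) ^ 2 + (Real.sin a + Real.cos b) ^ 2 =
      2 * (1 + Real.sin (a + b)) := by
  rw [Real.sin_add]
  linear_combination Real.sin_sq_add_cos_sq a + Real.sin_sq_add_cos_sq b

theorem sq_sub_sq_cos_add_sin (a b : ℝ) :
    (Real.cos a + Real.sin b) ^ 2 - (Real.sin a + Real.cos b) ^ 2 =
      Real.sin (b - a) * (2 * (1 + Real.sin (a + b))) := by
  rw [Real.sin_add, Real.sin_sub]
  linear_combination
    (1 - 2 * Real.sin b ^ 2) * Real.sin_sq_add_cos_sq a +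
      (2 * Real.sin a ^ 2 - 1) * Real.sin_sq_add_cos_sq b

/-- explicit inverse of `h(t,ν) = e^{2πit/12} + i·e^{−2πiν/12}` on
`[0,1)²`: writing `h(t,ν) = x + iy`, one recovers
`t = (3/π)(arcsin((x²+y²−2)/2) − arcsin((x²−y²)/(x²+y²)))` and
`ν = (3/π)(arcsin((x²+y²−2)/2) + arcsin((x²−y²)/(x²+y²)))`. -/
theorem statement_12 (t ν : ℝ)
    (ht : t ∈ Set.Ico (0 : ℝ) 1) (hν : ν ∈ Set.Ico (0 : ℝ) 1)
    (x y : ℝ)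
    (hx : x = (Complex.exp (2 * (Real.pi : ℂ) * Complex.I * t / 12) +
        Complex.I * Complex.exp (-(2 * (Real.pi : ℂ) * Complex.I * ν) / 12)).re)
    (hy : y = (Complex.exp (2 * (Real.pi : ℂ) * Complex.I * t / 12) +
        Complex.I * Complex.exp (-(2 * (Real.pi : ℂ) * Complex.I * ν) / 12)).im) :
    t = (3 / Real.pi) *
        (Real.arcsin ((x ^ 2 + y ^ 2 - 2) / 2) -
          Real.arcsin ((x ^ 2 - y ^ 2) / (x ^ 2 + y ^ 2))) ∧
    ν = (3 / Real.pi) *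
        (Real.arcsin ((x ^ 2 + y ^ 2 - 2) / 2) +
          Real.arcsin ((x ^ 2 - y ^ 2) / (x ^ 2 + y ^ 2))) := by
  have hπ := Real.pi_pos
  obtain ⟨ht0, ht1⟩ := ht
  obtain ⟨hν0, hν1⟩ := hν
  obtain ⟨a, ha⟩ : ∃ a, a = Real.pi * t / 6 := ⟨_, rfl⟩
  obtain ⟨b, hb⟩ : ∃ b, b = Real.pi * ν / 6 := ⟨_, rfl⟩
  have hexp_t : Complex.exp (2 * (Real.pi : ℂ) * Complex.I * t / 12) =
      Complex.exp ((a : ℂ) * Complex.I) := by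
    rw [ha]; push_cast; ring_nf
  have hexp_ν : Complex.exp (-(2 * (Real.pi : ℂ) * Complex.I * ν) / 12) =
      Complex.exp (((-b : ℝ) : ℂ) * Complex.I) := by
    rw [hb]; push_cast; ring_nf
  have hx' : x = Real.cos a + Real.sin b := by
    rw [hx, hexp_t, hexp_ν, Complex.add_re, Complex.I_mul_re, Complex.exp_ofReal_mul_I_re,
      Complex.exp_ofReal_mul_I_im, Real.sin_neg, neg_neg]
  have hy' : y = Real.sin a + Real.cos b := by
    rw [hy, hexp_t, hexp_ν, Complex.add_im, Complex.I_mul_im, Complex.exp_ofReal_mul_I_im,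
      Complex.exp_ofReal_mul_I_re, Real.cos_neg]
  have ha0 : 0 ≤ a := by rw [ha]; positivity
  have hb0 : 0 ≤ b := by rw [hb]; positivity
  have ha1 : a < Real.pi / 6 := by rw [ha]; nlinarith
  have hb1 : b < Real.pi / 6 := by rw [hb]; nlinarith
  have hsin : 0 ≤ Real.sin (a + b) :=
    Real.sin_nonneg_of_nonneg_of_le_pi (by linarith) (by linarith)
  have hadd : Real.arcsin ((x ^ 2 + y ^ 2 - 2) / 2) = a + b := by
    rw [hx', hy', sq_add_sq_cos_add_sin,
      show (2 * (1 + Real.sin (a + b)) - 2) / 2 = Real.sin (a + b) by ring]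
    exact Real.arcsin_sin (by linarith) (by linarith)
  have hsub : Real.arcsin ((x ^ 2 - y ^ 2) / (x ^ 2 + y ^ 2)) = b - a := by
    rw [hx', hy', sq_add_sq_cos_add_sin, sq_sub_sq_cos_add_sin,
      mul_div_cancel_right₀ _ (by positivity)]
    exact Real.arcsin_sin (by linarith) (by linarith)
  rw [hadd, hsub, ha, hb]
  constructor <;> field_simp <;> ring
end

section
/- Let M ≥ 0 be an integer, γ ∈ ℝ, 0 ≤ m ≤ M, and let f : ℝ → ℂ be a measurable function with ∫_ℝ |f(s)|(1+|s|)^M ds < ∞. Define the Fourier transform f̂(ξ) = ∫_ℝ f(s)e^{−2πisξ} ds. If f̂ vanishes on an open neighborhood of γ, then the convolution of f with the function x_γ^m(s) = s^m e^{2πiγs} is identically zero: ∫_ℝ f(s)(t−s)^m e^{2πiγ(t−s)} ds = 0 for every t ∈ ℝ. -/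
open MeasureTheory

open scoped FourierTransform

/-- Moments of order at most `M` are integrable against the weight `(1 + |s|) ^ M`. -/
lemma integrable_pow_smul_of_weight {M k : ℕ} (hk : k ≤ M) {f : ℝ → ℂ} (hmeas : Measurable f)
    (hint : Integrable (fun s : ℝ => ‖f s‖ * (1 + |s|) ^ M)) :
    Integrable (fun s : ℝ => s ^ k • f s) := by
  refine hint.mono' (by fun_prop) (.of_forall fun s => ?_)
  rw [norm_smul, norm_pow, Real.norm_eq_abs, mul_comm]
  gcongr
  calc |s| ^ k ≤ (1 + |s|) ^ k := by gcongr; linarith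
    _ ≤ (1 + |s|) ^ M := pow_le_pow_right₀ (by linarith [abs_nonneg s]) hk

/-- If the Fourier transform of `f` vanishes near `γ`, then so do the moments of
`s ↦ f s * exp (-2πisγ)` which exist. -/
lemma integral_moment_eq_zero_of_fourier_eventuallyEq_zero {k : ℕ} {f : ℝ → ℂ} {γ : ℝ}
    (hf : ∀ j ≤ k, Integrable (fun s : ℝ => s ^ j • f s))
    (h : 𝓕 f =ᶠ[nhds γ] 0) :
    ∫ s : ℝ, (s : ℂ) ^ k * f s * Complex.exp (-(2 * Real.pi * Complex.I * s * γ)) = 0 := by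
  have hderiv : iteratedDeriv k (𝓕 f) γ = 0 := by
    rw [h.iteratedDeriv_eq]
    simp
  rw [Real.iteratedDeriv_fourier (N := k) (fun j hj => hf j (by exact_mod_cast hj)) le_rfl,
    Real.fourier_real_eq_integral_exp_smul] at hderiv
  have hc : (-2 * (Real.pi : ℂ) * Complex.I) ^ k ≠ 0 := by
    simp [Real.pi_ne_zero]
  refine (mul_eq_zero.mp ?_).resolve_left hc
  rw [← integral_const_mul, ← hderiv]
  congr with s
  have harg : ((-2 * Real.pi * s * γ : ℝ) : ℂ) * Complex.I
      = -(2 * Real.pi * Complex.I * s * γ) := by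
    push_cast
    ring
  simp only [harg, smul_eq_mul, mul_pow]
  ring

/-- for `f` measurable with `∫ |f(s)|(1+|s|)^M ds < ∞` and `0 ≤ m ≤ M`,
if the Fourier transform `f̂(ξ) = ∫ f(s)e^{−2πisξ} ds` vanishes on an open neighborhood
of `γ`, then the convolution of `f` with `x_γ^m(s) = s^m e^{2πiγs}` is identically
zero: `∫ f(s)(t−s)^m e^{2πiγ(t−s)} ds = 0` for every `t ∈ ℝ`. -/
theorem statement_14 (M m : ℕ) (hm : m ≤ M) (γ : ℝ)
    (f : ℝ → ℂ) (hmeas : Measurable f)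
    (hint : Integrable (fun s : ℝ => ‖f s‖ * (1 + |s|) ^ M) (volume : Measure ℝ))
    (U : Set ℝ) (hU : IsOpen U) (hγU : γ ∈ U)
    (hvanish : ∀ ξ ∈ U,
      (∫ s : ℝ, f s * Complex.exp (-(2 * (Real.pi : ℂ) * Complex.I * s * ξ))) = 0) :
    ∀ t : ℝ,
      (∫ s : ℝ, f s * ((t : ℂ) - (s : ℂ)) ^ m *
          Complex.exp (2 * (Real.pi : ℂ) * Complex.I * γ * ((t : ℂ) - (s : ℂ)))) = 0 := by
  intro t
  have hf (k : ℕ) (hk : k ≤ M) := integrable_pow_smul_of_weight hk hmeas hint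
  have hzero : 𝓕 f =ᶠ[nhds γ] 0 := by
    filter_upwards [hU.mem_nhds hγU] with ξ hξ
    rw [Real.fourier_real_eq_integral_exp_smul, Pi.zero_apply, ← hvanish ξ hξ]
    congr with s
    rw [smul_eq_mul, mul_comm]
    congr 2
    push_cast
    ring
  let e (s : ℝ) : ℂ := Complex.exp (-(2 * Real.pi * Complex.I * s * γ))
  have hexpand (s : ℝ) : f s * ((t : ℂ) - s) ^ m *
      Complex.exp (2 * Real.pi * Complex.I * γ * ((t : ℂ) - s)) =
      ∑ k ∈ Finset.range (m + 1),
        (Complex.exp (2 * Real.pi * Complex.I * γ * t) * (-1) ^ k * t ^ (m - k) * m.choose k) *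
          ((s : ℂ) ^ k * f s * e s) := by
    have hexp : Complex.exp (2 * Real.pi * Complex.I * γ * ((t : ℂ) - s)) =
        Complex.exp (2 * Real.pi * Complex.I * γ * t) * e s := by
      rw [← Complex.exp_add]
      ring_nf
    rw [hexp, sub_eq_neg_add, add_pow, Finset.mul_sum, Finset.sum_mul]
    refine Finset.sum_congr rfl fun k _ => ?_
    rw [neg_pow]
    ring
  simp_rw [hexpand]
  rw [integral_finsetSum]
  · refine Finset.sum_eq_zero fun k hk => ?_
    have hkm : k ≤ m := Finset.mem_range_succ_iff.mp hk
    rw [integral_const_mul, integral_moment_eq_zero_of_fourier_eventuallyEq_zero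
      (fun j hj => hf j (hj.trans (hkm.trans hm))) hzero, mul_zero]
  · intro k hk
    refine Integrable.const_mul ?_ _
    refine (hf k ((Finset.mem_range_succ_iff.mp hk).trans hm)).mono (by fun_prop)
      (.of_forall fun s => ?_)
    simp [e, Complex.norm_exp]
end
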